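/- (Enlarged identification.) Let M₁, …, M_m be linear subspaces of ℝⁿ. Let g be convex, proper, lower semicontinuous, γ > 0, and prox : ℝⁿ → ℝⁿ a map such that prox(u) minimizes y ↦ g(y) + ‖y − u‖²/(2γ) for every u. Let (uᵏ) be a sequence of ℝⁿ-valued random vectors converging almost surely to a point u* ∈ ℝⁿ, and set xᵏ = prox(uᵏ) and x* = prox(u*). Then for every ε > 0, almost surely there exists K such that for all k ≥ K and every i ∈ {1, …, m}: (i) if xᵏ ∈ M_i then x* ∈ M_i (i.e., S(x*) ≤ S(xᵏ)); and (ii) if prox(u) ∈ M_i for every u with ‖u − u*‖ ≤ ε, then xᵏ ∈ M_i (i.e., S(xᵏ) ≤ ∪_{u ∈ B(u*, ε)} S(prox(u))). -/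

import Mathlib

open MeasureTheory Filter
open scoped RealInnerProductSpace

/-- Optimality of `p` tested at the midpoint of `p` and `q`. -/
lemma prox_half {n : ℕ} (γ : ℝ) (hγ : 0 < γ)
    (g : EuclideanSpace ℝ (Fin n) → EReal)
    (hg_conv : ∀ x y : EuclideanSpace ℝ (Fin n), ∀ a b : ℝ, 0 ≤ a → 0 ≤ b → a + b = 1 →
      g (a • x + b • y) ≤ (a : EReal) * g x + (b : EReal) * g y)
    (u p q : EuclideanSpace ℝ (Fin n)) (G H : ℝ) (hG : g p = (G : EReal)) (hH : g q = (H : EReal))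
    (hp : ∀ v, g p + ((‖p - u‖ ^ 2 / (2 * γ) : ℝ) : EReal)
      ≤ g v + ((‖v - u‖ ^ 2 / (2 * γ) : ℝ) : EReal)) :
    (G - H) * (2 * γ) ≤ 2 * ⟪q - p, p - u⟫ + ‖q - p‖ ^ 2 / 2 := by
  have h1 := hp ((1/2 : ℝ) • p + (1/2 : ℝ) • q)
  have h2 := hg_conv p q (1/2) (1/2) (by norm_num) (by norm_num) (by norm_num)
  have h3 := h1.trans (add_le_add_left h2 _)
  rw [hG, hH] at h3
  have h4 : G + ‖p - u‖ ^ 2 / (2 * γ) ≤ (1/2) * G + (1/2) * H +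
      ‖(1/2 : ℝ) • p + (1/2 : ℝ) • q - u‖ ^ 2 / (2 * γ) := by exact_mod_cast h3
  have h5 : (1/2 : ℝ) • p + (1/2 : ℝ) • q - u = (p - u) + (1/2 : ℝ) • (q - p) := by module
  rw [h5, norm_add_sq_real, inner_smul_right, norm_smul, real_inner_comm] at h4
  have h6 : (0:ℝ) < 2 * γ := by positivity
  have h7 := mul_le_mul_of_nonneg_right h4 h6.le
  simp only [add_mul, div_mul_cancel₀ _ h6.ne'] at h7
  norm_num at h7
  nlinarith

lemma prox_lipschitz {n : ℕ} (γ : ℝ) (hγ : 0 < γ)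
    (g : EuclideanSpace ℝ (Fin n) → EReal)
    (hg_conv : ∀ x y : EuclideanSpace ℝ (Fin n), ∀ a b : ℝ, 0 ≤ a → 0 ≤ b → a + b = 1 →
      g (a • x + b • y) ≤ (a : EReal) * g x + (b : EReal) * g y)
    (hg_ne_bot : ∀ x, g x ≠ ⊥) (hg_proper : ∃ x, g x ≠ ⊤)
    (prox : EuclideanSpace ℝ (Fin n) → EuclideanSpace ℝ (Fin n))
    (hprox : ∀ u, IsMinOn
      (fun v => g v + ((‖v - u‖ ^ 2 / (2 * γ) : ℝ) : EReal)) Set.univ (prox u)) :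
    Continuous prox := by
  have hp : ∀ u v, g (prox u) + ((‖prox u - u‖ ^ 2 / (2 * γ) : ℝ) : EReal)
      ≤ g v + ((‖v - u‖ ^ 2 / (2 * γ) : ℝ) : EReal) := fun u v => hprox u (Set.mem_univ v)
  have hfin : ∀ u, ∃ G : ℝ, g (prox u) = (G : EReal) := by
    intro u
    obtain ⟨z, hz⟩ := hg_proper
    refine ⟨(g (prox u)).toReal, (EReal.coe_toReal ?_ (hg_ne_bot _)).symm⟩
    intro h
    have h1 := hp u z
    rw [h, EReal.top_add_coe, top_le_iff] at h1
    exact EReal.add_ne_top hz (EReal.coe_ne_top _) h1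
  have hL : LipschitzWith 2 prox := by
    refine LipschitzWith.of_dist_le_mul fun u v => ?_
    obtain ⟨G, hG⟩ := hfin u
    obtain ⟨H, hH⟩ := hfin v
    have h1 := prox_half γ hγ g hg_conv u _ _ G H hG hH (hp u)
    have h2 := prox_half γ hγ g hg_conv v _ _ H G hH hG (hp v)
    rw [dist_eq_norm, dist_eq_norm]
    generalize prox u = p at *
    generalize prox v = q at *
    have h3 := real_inner_le_norm (p - q) (u - v)
    have h4 : ⟪q - p, p - u⟫ + ⟪p - q, q - v⟫ = ⟪p - q, u - v⟫ - ‖p - q‖ ^ 2 := by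
      rw [← real_inner_self_eq_norm_sq, ← neg_sub p q, inner_neg_left, ← sub_eq_zero]
      simp only [inner_sub_right]
      ring
    rw [norm_sub_rev q p] at h1
    have h5 : ‖p - q‖ ^ 2 ≤ 2 * (‖p - q‖ * ‖u - v‖) := by linarith
    push_cast
    by_contra! h
    have := norm_nonneg (u - v)
    nlinarith
  exact hL.continuous

theorem statement9
    {n m : ℕ} {Ω : Type*} [MeasurableSpace Ω] (μ : Measure Ω) [IsProbabilityMeasure μ]
    (M : Fin m → Submodule ℝ (EuclideanSpace ℝ (Fin n)))
    (γ : ℝ) (hγ : 0 < γ)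
    (g : EuclideanSpace ℝ (Fin n) → EReal)
    (hg_conv : ∀ x y : EuclideanSpace ℝ (Fin n), ∀ a b : ℝ, 0 ≤ a → 0 ≤ b → a + b = 1 →
      g (a • x + b • y) ≤ (a : EReal) * g x + (b : EReal) * g y)
    (hg_ne_bot : ∀ x, g x ≠ ⊥) (hg_proper : ∃ x, g x ≠ ⊤)
    (hg_lsc : LowerSemicontinuous g)
    (prox : EuclideanSpace ℝ (Fin n) → EuclideanSpace ℝ (Fin n))
    (hprox : ∀ u, IsMinOn
      (fun v => g v + ((‖v - u‖ ^ 2 / (2 * γ) : ℝ) : EReal)) Set.univ (prox u))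
    (u : ℕ → Ω → EuclideanSpace ℝ (Fin n)) (ustar : EuclideanSpace ℝ (Fin n))
    (hconv : ∀ᵐ ω ∂μ, Tendsto (fun k => u k ω) atTop (nhds ustar))
    (x : ℕ → Ω → EuclideanSpace ℝ (Fin n))
    (hx : ∀ k ω, x k ω = prox (u k ω))
    (xstar : EuclideanSpace ℝ (Fin n)) (hxstar : xstar = prox ustar) :
    ∀ ε : ℝ, 0 < ε → ∀ᵐ ω ∂μ, ∃ K : ℕ, ∀ k, K ≤ k → ∀ i : Fin m,
      (x k ω ∈ M i → xstar ∈ M i) ∧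
      ((∀ u' : EuclideanSpace ℝ (Fin n), ‖u' - ustar‖ ≤ ε → prox u' ∈ M i) →
        x k ω ∈ M i) := by
  intro ε hε
  have hc := prox_lipschitz γ hγ g hg_conv hg_ne_bot hg_proper prox hprox
  filter_upwards [hconv] with ω hω
  have hxt : Tendsto (fun k => x k ω) atTop (nhds xstar) := by
    simp only [hx, hxstar]
    exact (hc.tendsto ustar).comp hω
  have h1 : ∀ᶠ k in atTop, ∀ i : Fin m, x k ω ∈ M i → xstar ∈ M i := by
    rw [eventually_all]
    intro i
    by_cases hi : xstar ∈ M i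
    · exact Eventually.of_forall fun _ _ => hi
    · have ho : IsOpen ((M i : Set (EuclideanSpace ℝ (Fin n)))ᶜ) :=
        (M i).closed_of_finiteDimensional.isOpen_compl
      filter_upwards [hxt.eventually (ho.mem_nhds hi)] with k hk hk'
      exact absurd hk' hk
  have h2 : ∀ᶠ k in atTop, ‖u k ω - ustar‖ ≤ ε := by
    filter_upwards [hω.eventually (Metric.closedBall_mem_nhds ustar hε)] with k hk
    rwa [← dist_eq_norm]
  obtain ⟨K, hK⟩ := eventually_atTop.1 (h1.and h2)
  refine ⟨K, fun k hk i => ⟨(hK k hk).1 i, fun h => ?_⟩⟩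
  rw [hx]
  exact h _ (hK k hk).2
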